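/- (Conditional estimate used in the proof of Theorem 4.1.) If E₀ ≥ 0 and E₀² ≥ (1/2)(|c'|² + |J₍₄₎|²), then 2c₄'(c·J₍₄₎) + 2(c×c')·Ĵ − 2c₄(c'·J₍₄₎) ≤ 2√2 · E₀ · √((c₄c₁'−c₄'c₁)² + (c₄c₂'−c₄'c₂)² + (c₄c₃'−c₄'c₃)² + |c×Ĵ|²). -/

import Mathlib

noncomputable section

open Matrix
open scoped ComplexOrder

/-- Euclidean dot product on ℝ³. -/
def dot3 (u v : Fin 3 → ℝ) : ℝ := u 0 * v 0 + u 1 * v 1 + u 2 * v 2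

/-- Cross product on ℝ³. -/
def cross3 (u v : Fin 3 → ℝ) : Fin 3 → ℝ :=
  ![u 1 * v 2 - u 2 * v 1, u 2 * v 0 - u 0 * v 2, u 0 * v 1 - u 1 * v 0]

/-- Euclidean norm on ℝ³. -/
def norm3 (u : Fin 3 → ℝ) : ℝ := Real.sqrt (dot3 u u)

/-- The 4×4 Hermitian matrix Q = [[E, L], [L*, Ê]] from the positive energy theorem. -/
def Qmat (E₀ c₁ c₂ c₃ c₄ c₁' c₂' c₃' c₄' J₁₂ J₁₃ J₂₃ J₁₄ J₂₄ J₃₄ : ℝ) :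
    Matrix (Fin 4) (Fin 4) ℂ :=
  !![((E₀ + c₄ + c₃' - J₃₄ : ℝ) : ℂ),
     (c₁' : ℂ) + Complex.I * (c₂' : ℂ) - (J₁₄ : ℂ) - Complex.I * (J₂₄ : ℂ),
     (c₃ : ℂ) - (c₄' : ℂ) + Complex.I * (J₁₂ : ℂ),
     (c₁ : ℂ) + Complex.I * (c₂ : ℂ) + (J₁₃ : ℂ) + Complex.I * (J₂₃ : ℂ);
     (c₁' : ℂ) - Complex.I * (c₂' : ℂ) - (J₁₄ : ℂ) + Complex.I * (J₂₄ : ℂ),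
     ((E₀ + c₄ - c₃' + J₃₄ : ℝ) : ℂ),
     (c₁ : ℂ) - Complex.I * (c₂ : ℂ) - (J₁₃ : ℂ) + Complex.I * (J₂₃ : ℂ),
     -(c₃ : ℂ) - (c₄' : ℂ) - Complex.I * (J₁₂ : ℂ);
     (c₃ : ℂ) - (c₄' : ℂ) - Complex.I * (J₁₂ : ℂ),
     (c₁ : ℂ) + Complex.I * (c₂ : ℂ) - (J₁₃ : ℂ) - Complex.I * (J₂₃ : ℂ),
     ((E₀ - c₄ - c₃' - J₃₄ : ℝ) : ℂ),
     -(c₁' : ℂ) - Complex.I * (c₂' : ℂ) - (J₁₄ : ℂ) - Complex.I * (J₂₄ : ℂ);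
     (c₁ : ℂ) - Complex.I * (c₂ : ℂ) + (J₁₃ : ℂ) - Complex.I * (J₂₃ : ℂ),
     -(c₃ : ℂ) - (c₄' : ℂ) + Complex.I * (J₁₂ : ℂ),
     -(c₁' : ℂ) + Complex.I * (c₂' : ℂ) - (J₁₄ : ℂ) + Complex.I * (J₂₄ : ℂ),
     ((E₀ - c₄ + c₃' + J₃₄ : ℝ) : ℂ)]

/-- Cauchy–Schwarz for a pair of vectors of ℝ³, bounding the sum of the two dot products. -/
theorem neg_dot3_add_dot3_le (w v a b : Fin 3 → ℝ) :
    -(dot3 w a + dot3 v b) ≤ √(dot3 w w + dot3 v v) * √(dot3 a a + dot3 b b) := by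
  have h := Real.sum_mul_le_sqrt_mul_sqrt (Finset.univ : Finset (Fin 3 ⊕ Fin 3))
    (Sum.elim (-w) (-v)) (Sum.elim a b)
  simp only [Fintype.sum_sum_type, Fin.sum_univ_three, Sum.elim_inl, Sum.elim_inr, Pi.neg_apply,
    neg_sq] at h
  simp only [dot3, ← sq]
  linarith

theorem norm3_sq (u : Fin 3 → ℝ) : norm3 u ^ 2 = dot3 u u := by
  refine Real.sq_sqrt ?_
  simp only [dot3, ← sq]
  positivity

theorem stmt10 (E₀ c₁ c₂ c₃ c₄ c₁' c₂' c₃' c₄' J₁₂ J₁₃ J₂₃ J₁₄ J₂₄ J₃₄ : ℝ)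
    (hE : 0 ≤ E₀)
    (h2 : E₀ ^ 2 ≥ (1 / 2) * (norm3 ![c₁', c₂', c₃'] ^ 2 + norm3 ![J₁₄, J₂₄, J₃₄] ^ 2)) :
    2 * c₄' * dot3 ![c₁, c₂, c₃] ![J₁₄, J₂₄, J₃₄] + 2 * dot3 (cross3 ![c₁, c₂, c₃] ![c₁', c₂', c₃']) ![J₂₃, -J₁₃, J₁₂]
      - 2 * c₄ * dot3 ![c₁', c₂', c₃'] ![J₁₄, J₂₄, J₃₄]
    ≤ 2 * Real.sqrt 2 * E₀ * Real.sqrt ((c₄ * c₁' - c₄' * c₁) ^ 2 + (c₄ * c₂' - c₄' * c₂) ^ 2 + (c₄ * c₃' - c₄' * c₃) ^ 2 + norm3 (cross3 ![c₁, c₂, c₃] ![J₂₃, -J₁₃, J₁₂]) ^ 2) := by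
  simp only [norm3_sq] at h2 ⊢
  set c : Fin 3 → ℝ := ![c₁, c₂, c₃] with hc
  set c' : Fin 3 → ℝ := ![c₁', c₂', c₃'] with hc'
  set J : Fin 3 → ℝ := ![J₁₄, J₂₄, J₃₄]
  set K : Fin 3 → ℝ := ![J₂₃, -J₁₃, J₁₂]
  set S := (c₄ * c₁' - c₄' * c₁) ^ 2 + (c₄ * c₂' - c₄' * c₂) ^ 2 + (c₄ * c₃' - c₄' * c₃) ^ 2
    + dot3 (cross3 c K) (cross3 c K) with hS
  have hCS := neg_dot3_add_dot3_le (c₄ • c' - c₄' • c) (cross3 c K) J c'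
  have hw : dot3 (c₄ • c' - c₄' • c) (c₄ • c' - c₄' • c) + dot3 (cross3 c K) (cross3 c K) = S := by
    rw [hS]
    simp [dot3, hc, hc', ← sq]
  have hlhs : 2 * c₄' * dot3 c J + 2 * dot3 (cross3 c c') K - 2 * c₄ * dot3 c' J
      = 2 * -(dot3 (c₄ • c' - c₄' • c) J + dot3 (cross3 c K) c') := by
    simp [dot3, cross3]
    ring
  have hJ : √(dot3 J J + dot3 c' c') ≤ √2 * E₀ := by
    refine Real.sqrt_le_iff.mpr ⟨by positivity, ?_⟩
    rw [mul_pow, Real.sq_sqrt zero_le_two]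
    linarith
  rw [hw] at hCS
  rw [hlhs]
  have := mul_le_mul_of_nonneg_left hJ (Real.sqrt_nonneg S)
  linarith
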